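/- Suppose every monomial of Q has total degree belonging to {n₀, n₁, …, n_{ℓ_d}} and that ν·n_{ℓ+1} > n_ℓ·D for every ℓ ∈ {0,…,ℓ_d−1}. Then Q(P₁,P₂) = 0 in ℂ[X] if and only if Q_{n_ℓ}(P₁,P₂) = 0 for every ℓ ∈ {0,…,ℓ_d}, where Q_{n_ℓ} denotes the homogeneous part of Q of total degree n_ℓ. -/

import Mathlib

open Polynomial

theorem MvPolynomial.IsHomogeneous.pow_dvd_aeval {σ R A : Type*} [CommSemiring R] [CommSemiring A]
    [Algebra R A] {F : MvPolynomial σ R} {m : ℕ} (hF : F.IsHomogeneous m) {f : σ → A} {a : A}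
    (hf : ∀ i, a ∣ f i) : a ^ m ∣ MvPolynomial.aeval f F := by
  rw [MvPolynomial.aeval_def, MvPolynomial.eval₂_eq]
  refine Finset.dvd_sum fun d hd => Dvd.dvd.mul_left ?_ _
  rw [hF.degree_eq_sum_deg_support hd, ← Finset.prod_pow_eq_pow_sum]
  exact Finset.prod_dvd_prod_of_dvd _ _ fun i _ => pow_dvd_pow_of_dvd (hf i) _

theorem MvPolynomial.sum_homogeneousComponent_of_support {σ R : Type*} [CommSemiring R]
    {F : MvPolynomial σ R} {s : Finset ℕ} (hs : ∀ d ∈ F.support, d.degree ∈ s) :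
    ∑ m ∈ s, MvPolynomial.homogeneousComponent m F = F := by
  ext d
  simp only [MvPolynomial.coeff_sum, MvPolynomial.coeff_homogeneousComponent, Finset.sum_ite_eq]
  split_ifs with h
  · rfl
  · exact (MvPolynomial.notMem_support_iff.mp (mt (hs d) h)).symm

/-- A sum of polynomials whose ranges of exponents lie in successive disjoint intervals vanishes
only if every summand does. -/
theorem Polynomial.eq_zero_of_sum_eq_zero_of_natDegree_lt {R : Type*} [Semiring R] {N : ℕ}
    {f : ℕ → R[X]} {b : ℕ → ℕ} (hdvd : ∀ i ≤ N, X ^ b i ∣ f i)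
    (hdeg : ∀ i j, i < j → j ≤ N → (f i).natDegree < b j)
    (hsum : ∑ i ∈ Finset.range (N + 1), f i = 0) : ∀ i ≤ N, f i = 0 := by
  intro i
  induction i using Nat.strong_induction_on with
  | _ i ih =>
    intro hi
    rw [← leadingCoeff_eq_zero, leadingCoeff]
    have h := congrArg (fun p => p.coeff (f i).natDegree) hsum
    simp only [finsetSum_coeff, coeff_zero] at h
    rwa [Finset.sum_eq_single_of_mem i (by simpa [Nat.lt_succ_iff] using hi)] at h
    intro j hj hji
    have hjN : j ≤ N := Nat.lt_succ_iff.mp (Finset.mem_range.mp hj)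
    rcases hji.lt_or_gt with hlt | hgt
    · rw [ih j hlt hjN, coeff_zero]
    · exact X_pow_dvd_iff.mp (hdvd j hjN) _ (hdeg i j hgt hjN)

/-- Under the lacunarity condition `ν·n_{ℓ+1} > n_ℓ·D`,
`Q(P₁,P₂) = 0` iff each homogeneous part `Q_{n_ℓ}` satisfies `Q_{n_ℓ}(P₁,P₂) = 0`. -/
theorem stmt_1
    (P₁ P₂ : Polynomial ℂ) (hP₁ : P₁ ≠ 0) (hP₂ : P₂ ≠ 0)
    (hP₁0 : P₁.eval 0 = 0) (hP₂0 : P₂.eval 0 = 0)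
    (D ν : ℕ) (hD : D = max P₁.natDegree P₂.natDegree)
    (hν : ν = min (P₁.rootMultiplicity 0) (P₂.rootMultiplicity 0))
    (Q : MvPolynomial (Fin 2) ℂ)
    (ℓd : ℕ) (n : ℕ → ℕ)
    (hmono : StrictMonoOn n (Set.Iic ℓd))
    (hsupp : ∀ e ∈ Q.support, ∃ ℓ ≤ ℓd, (e.sum fun _ k => k) = n ℓ)
    (hlac : ∀ ℓ < ℓd, n ℓ * D < ν * n (ℓ + 1)) :
    MvPolynomial.aeval ![P₁, P₂] Q = 0 ↔
      ∀ ℓ ≤ ℓd, MvPolynomial.aeval ![P₁, P₂] (MvPolynomial.homogeneousComponent (n ℓ) Q) = 0 := by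
  have hsum : MvPolynomial.aeval ![P₁, P₂] Q = ∑ ℓ ∈ Finset.range (ℓd + 1),
      MvPolynomial.aeval ![P₁, P₂] (MvPolynomial.homogeneousComponent (n ℓ) Q) := by
    have hinj : Set.InjOn n (Finset.range (ℓd + 1)) :=
      hmono.injOn.mono fun ℓ hℓ => Nat.lt_succ_iff.mp (Finset.mem_range.mp hℓ)
    have hQ : ∀ e ∈ Q.support, e.degree ∈ (Finset.range (ℓd + 1)).image n := by
      intro e he
      obtain ⟨ℓ, hℓ, h⟩ := hsupp e he
      exact Finset.mem_image.mpr ⟨ℓ, Finset.mem_range.mpr (Nat.lt_succ_iff.mpr hℓ), h.symm⟩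
    conv_lhs => rw [← MvPolynomial.sum_homogeneousComponent_of_support hQ]
    rw [Finset.sum_image hinj, map_sum]
  constructor
  · intro h
    have hX : ∀ i, X ^ ν ∣ ![P₁, P₂] i := by
      have key : ∀ P : ℂ[X], X ^ P.rootMultiplicity 0 ∣ P := fun P => by
        simpa using P.pow_rootMultiplicity_dvd 0
      simp only [Fin.forall_fin_two, hν]
      exact ⟨(pow_dvd_pow X (min_le_left _ _)).trans (key P₁),
        (pow_dvd_pow X (min_le_right _ _)).trans (key P₂)⟩
    have hd : ∀ i, (![P₁, P₂] i).natDegree ≤ D := by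
      simp [Fin.forall_fin_two, hD]
    refine eq_zero_of_sum_eq_zero_of_natDegree_lt (b := fun ℓ => ν * n ℓ) ?_ ?_ (hsum ▸ h)
    · intro ℓ _
      rw [pow_mul]
      exact (MvPolynomial.homogeneousComponent_isHomogeneous _ _).pow_dvd_aeval hX
    · intro i j hij hj
      calc _ ≤ n i * D := MvPolynomial.aeval_natDegree_le _
            (MvPolynomial.homogeneousComponent_isHomogeneous _ _).totalDegree_le _ hd
        _ < ν * n (i + 1) := hlac i (hij.trans_le hj)
        _ ≤ ν * n j := Nat.mul_le_mul_left _
            (hmono.monotoneOn (Set.mem_Iic.mpr (hij.trans_le hj)) hj hij)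
  · intro h
    rw [hsum]
    exact Finset.sum_eq_zero fun ℓ hℓ => h ℓ (Nat.lt_succ_iff.mp (Finset.mem_range.mp hℓ))
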